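/- Threshold direct product theorem: there exist universal constants c ∈ (1/2, 1) and c' > 0 such that for every (possibly partial) function f : X → {0,1} with X ⊆ {0,1}^m, every n ∈ ℕ, every integer k with n/2 < k ≤ n, and every γ ∈ [c, 1), setting τ_{n,k} = n − log₂(Σ_{i=0}^{n−k} C(n,i)), the worst-case randomized query complexity of the k-of-n threshold task satisfies R_{γ^{τ_{n,k}}}(Thr_k^n ∘ f) ≥ c'·τ_{n,k}·R(f), where R(f) = R_{2/3}(f). -/

import Mathlib

open Finset

/-- Deterministic decision trees querying coordinates `i : ι` of inputs `x : ι → Bool`,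
with leaves labelled by elements of `L`. -/
inductive DTree (ι : Type) (L : Type) : Type
  | leaf (lab : L) : DTree ι L
  | node (i : ι) (t0 : DTree ι L) (t1 : DTree ι L) : DTree ι L

namespace DTree

variable {ι L : Type}

/-- Output label at the leaf reached by input `x`. -/
def out : DTree ι L → (ι → Bool) → L
  | .leaf lab, _ => lab
  | .node i t0 t1, x => if x i then out t1 x else out t0 x

/-- Number of queries made on input `x` (depth of the leaf reached by `x`). -/
def cost : DTree ι L → (ι → Bool) → ℕ
  | .leaf _, _ => 0
  | .node i t0 t1, x => (if x i then cost t1 x else cost t0 x) + 1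

/-- Maximum leaf depth of the tree. -/
def depth : DTree ι L → ℕ
  | .leaf _ => 0
  | .node _ t0 t1 => max (depth t0) (depth t1) + 1

/-- The set of inputs reaching the same leaf as input `x`. -/
def leafSet : DTree ι L → (ι → Bool) → Set (ι → Bool)
  | .leaf _, _ => Set.univ
  | .node i t0 t1, x => {y | y i = x i} ∩ (if x i then leafSet t1 x else leafSet t0 x)

/-- Every leaf label of the tree satisfies the predicate `P`. -/
def allLabels : DTree ι L → (L → Prop) → Prop
  | .leaf lab, P => P lab
  | .node _ t0 t1, P => allLabels t0 P ∧ allLabels t1 P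

end DTree

/-- A randomized query algorithm: a finitely supported probability distribution over
deterministic decision trees. -/
structure RandAlg (ι : Type) (L : Type) where
  k : ℕ
  p : Fin k → ℝ
  T : Fin k → DTree ι L
  p_nonneg : ∀ j, 0 ≤ p j
  p_sum : ∑ j, p j = 1

/-- A probability distribution on inputs, supported inside the domain `X`. -/
structure InputDist (ι : Type) [Fintype ι] [DecidableEq ι] (X : Set (ι → Bool)) where
  μ : (ι → Bool) → ℝ
  nonneg : ∀ x, 0 ≤ μ x
  sum_one : ∑ x, μ x = 1
  supp : ∀ x, x ∉ X → μ x = 0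

/-- A score function `φ : [0,1] → [1/2,1]`. -/
structure ScoreFun where
  φ : ℝ → ℝ
  continuous : ContinuousOn φ (Set.Icc 0 1)
  half_le : ∀ p ∈ Set.Icc (0:ℝ) 1, 1 / 2 ≤ φ p
  le_one : ∀ p ∈ Set.Icc (0:ℝ) 1, φ p ≤ 1
  map_zero : φ 0 = 1
  map_one : φ 1 = 1
  map_half : φ (1 / 2) = 1 / 2
  symm : ∀ p ∈ Set.Icc (0:ℝ) 1, φ (1 - p) = φ p
  mono : MonotoneOn φ (Set.Icc (1 / 2) 1)

section Defs

variable {ι L : Type} [Fintype ι] [DecidableEq ι]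

/-- Mass of a set of inputs under the weight function `μ`. -/
noncomputable def mass (μ : (ι → Bool) → ℝ) (S : Set (ι → Bool)) : ℝ :=
  ∑ x, Set.indicator S μ x

/-- Score `φ(μ(ℓ₁)/μ(ℓ))` of the leaf `ℓ` reached by `x` in the tree `t`. -/
noncomputable def leafScore (S : ScoreFun) (f : (ι → Bool) → Bool) (μ : (ι → Bool) → ℝ)
    (t : DTree ι L) (x : ι → Bool) : ℝ :=
  S.φ (mass μ (t.leafSet x ∩ {y | f y = true}) / mass μ (t.leafSet x))

/-- Score of a randomized algorithm: `E_{D∼R, x∼μ}[score(D(x))]`. -/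
noncomputable def algScore (S : ScoreFun) (f : (ι → Bool) → Bool) (μ : (ι → Bool) → ℝ)
    (R : RandAlg ι L) : ℝ :=
  ∑ j, R.p j * ∑ x, μ x * leafScore S f μ (R.T j) x

/-- Expected cost `E_{D∼R, x∼μ}[cost(D(x))]`. -/
noncomputable def expCost (μ : (ι → Bool) → ℝ) (R : RandAlg ι L) : ℝ :=
  ∑ j, R.p j * ∑ x, μ x * ((R.T j).cost x : ℝ)

/-- Score-weighted cost `E[score(D(x))·cost(D(x))] / E[score(D(x))]`. -/
noncomputable def scost (S : ScoreFun) (f : (ι → Bool) → Bool) (μ : (ι → Bool) → ℝ)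
    (R : RandAlg ι L) : ℝ :=
  (∑ j, R.p j * ∑ x, μ x * (leafScore S f μ (R.T j) x * ((R.T j).cost x : ℝ))) /
    algScore S f μ R

/-- Discounted score `E[score(D(x))·e^{-α·cost(D(x))}]`. -/
noncomputable def dScore (S : ScoreFun) (f : (ι → Bool) → Bool) (μ : (ι → Bool) → ℝ)
    (α : ℝ) (R : RandAlg ι L) : ℝ :=
  ∑ j, R.p j * ∑ x, μ x *
    (leafScore S f μ (R.T j) x * Real.exp (-(α * ((R.T j).cost x : ℝ))))

/-- Maximum discounted score `DS_α^μ(f)`. -/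
noncomputable def DS (S : ScoreFun) (f : (ι → Bool) → Bool) (μ : (ι → Bool) → ℝ)
    (α : ℝ) : ℝ :=
  ⨆ R : RandAlg ι Unit, dScore S f μ α R

/-- Distributional score-weighted query complexity `sR̄̄_γ^μ(f)`. -/
noncomputable def sRdist (S : ScoreFun) (f : (ι → Bool) → Bool) (μ : (ι → Bool) → ℝ)
    (γ : ℝ) : ℝ :=
  sInf {c | ∃ R : RandAlg ι Unit, γ ≤ algScore S f μ R ∧ scost S f μ R = c}

/-- Distributional query complexity `R̄̄_γ^μ(f)` (expected cost). -/
noncomputable def Rdist (S : ScoreFun) (f : (ι → Bool) → Bool) (μ : (ι → Bool) → ℝ)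
    (γ : ℝ) : ℝ :=
  sInf {c | ∃ R : RandAlg ι Unit, γ ≤ algScore S f μ R ∧ expCost μ R = c}

/-- Maximum score-weighted distributional query complexity `sR̄̄_γ(f)`. -/
noncomputable def sRmax (S : ScoreFun) (X : Set (ι → Bool)) (f : (ι → Bool) → Bool)
    (γ : ℝ) : ℝ :=
  ⨆ μ : InputDist ι X, sRdist S f μ.μ γ

/-- Maximum distributional query complexity `R̄̄_γ(f)`. -/
noncomputable def Rmax (S : ScoreFun) (X : Set (ι → Bool)) (f : (ι → Bool) → Bool)
    (γ : ℝ) : ℝ :=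
  ⨆ μ : InputDist ι X, Rdist S f μ.μ γ

/-- Success-probability score `max{μ(ℓ₀),μ(ℓ₁)}/μ(ℓ)` of the leaf reached by `x`. -/
noncomputable def succLeafScore (f : (ι → Bool) → Bool) (μ : (ι → Bool) → ℝ)
    (t : DTree ι L) (x : ι → Bool) : ℝ :=
  max (mass μ (t.leafSet x ∩ {y | f y = false})) (mass μ (t.leafSet x ∩ {y | f y = true})) /
    mass μ (t.leafSet x)

/-- Success-probability score of a randomized algorithm. -/
noncomputable def succAlgScore (f : (ι → Bool) → Bool) (μ : (ι → Bool) → ℝ)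
    (R : RandAlg ι L) : ℝ :=
  ∑ j, R.p j * ∑ x, μ x * succLeafScore f μ (R.T j) x

/-- Distributional query complexity with the success-probability score. -/
noncomputable def succRdist (f : (ι → Bool) → Bool) (μ : (ι → Bool) → ℝ) (γ : ℝ) : ℝ :=
  sInf {c | ∃ R : RandAlg ι Unit, γ ≤ succAlgScore f μ R ∧ expCost μ R = c}

/-- Maximum distributional query complexity `R̄̄_γ(f)` with the success-probability score. -/
noncomputable def succRmax (X : Set (ι → Bool)) (f : (ι → Bool) → Bool) (γ : ℝ) : ℝ :=
  ⨆ μ : InputDist ι X, succRdist f μ.μ γ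

/-- The fraction `q = μ(ℓ₁)/μ(ℓ)` at the leaf reached by `x`. -/
noncomputable def leafBias (f : (ι → Bool) → Bool) (μ : (ι → Bool) → ℝ)
    (t : DTree ι L) (x : ι → Bool) : ℝ :=
  mass μ (t.leafSet x ∩ {y | f y = true}) / mass μ (t.leafSet x)

/-- Hellinger loss `E[2·√(q(1-q))]` of a randomized algorithm. -/
noncomputable def helLossAlg (f : (ι → Bool) → Bool) (μ : (ι → Bool) → ℝ)
    (R : RandAlg ι L) : ℝ :=
  ∑ j, R.p j * ∑ x, μ x *
    (2 * Real.sqrt (leafBias f μ (R.T j) x * (1 - leafBias f μ (R.T j) x)))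

/-- Hellinger score `E[1 - √(q(1-q))]` of a randomized algorithm. -/
noncomputable def helScoreAlg (f : (ι → Bool) → Bool) (μ : (ι → Bool) → ℝ)
    (R : RandAlg ι L) : ℝ :=
  ∑ j, R.p j * ∑ x, μ x *
    (1 - Real.sqrt (leafBias f μ (R.T j) x * (1 - leafBias f μ (R.T j) x)))

/-- `R̄̄_{Hel↓,ε}(f)`: maximum distributional complexity at Hellinger loss `ε`. -/
noncomputable def RmaxHelLoss (X : Set (ι → Bool)) (f : (ι → Bool) → Bool) (ε : ℝ) : ℝ :=
  ⨆ μ : InputDist ι X,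
    sInf {c | ∃ R : RandAlg ι Unit, helLossAlg f μ.μ R ≤ ε ∧ expCost μ.μ R = c}

/-- `R̄̄_{Hel,γ}(f)`: maximum distributional complexity at Hellinger score `γ`. -/
noncomputable def RmaxHel (X : Set (ι → Bool)) (f : (ι → Bool) → Bool) (γ : ℝ) : ℝ :=
  ⨆ μ : InputDist ι X,
    sInf {c | ∃ R : RandAlg ι Unit, γ ≤ helScoreAlg f μ.μ R ∧ expCost μ.μ R = c}

/-- Binary entropy function. -/
noncomputable def binEnt (p : ℝ) : ℝ :=
  -(p * Real.logb 2 p) - (1 - p) * Real.logb 2 (1 - p)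

/-- Exponential-entropy score `E[1 - (1/2)·2^{-h(q)}]` of a randomized algorithm. -/
noncomputable def entScoreAlg (f : (ι → Bool) → Bool) (μ : (ι → Bool) → ℝ)
    (R : RandAlg ι L) : ℝ :=
  ∑ j, R.p j * ∑ x, μ x *
    (1 - (1 / 2) * (2:ℝ) ^ (-(binEnt (leafBias f μ (R.T j) x))))

/-- `R̄̄_{Ent,γ}(f)`: maximum distributional complexity at exponential-entropy score `γ`. -/
noncomputable def RmaxEnt (X : Set (ι → Bool)) (f : (ι → Bool) → Bool) (γ : ℝ) : ℝ :=
  ⨆ μ : InputDist ι X,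
    sInf {c | ∃ R : RandAlg ι Unit, γ ≤ entScoreAlg f μ.μ R ∧ expCost μ.μ R = c}

end Defs

section WorstCase

variable {ι L : Type}

open Classical in
/-- Worst-case randomized query complexity for a generic task: minimum, over randomized
algorithms whose leaf labels satisfy `labelOK` and which on every input `x ∈ X` output a
label `z` with `good x z` with probability at least `δ`, of the maximum leaf depth over
the trees in the support. -/
noncomputable def RwcTask (X : Set (ι → Bool)) (good : (ι → Bool) → L → Prop)
    (labelOK : L → Prop) (δ : ℝ) : ℕ :=
  sInf {d : ℕ | ∃ R : RandAlg ι L,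
    (∀ j, R.p j ≠ 0 → (R.T j).allLabels labelOK) ∧
    (∀ x ∈ X, δ ≤ ∑ j, if good x ((R.T j).out x) then R.p j else 0) ∧
    ∀ j, R.p j ≠ 0 → (R.T j).depth ≤ d}

/-- Worst-case randomized query complexity `R_δ(f)` of a (partial) Boolean function. -/
noncomputable def Rwc (X : Set (ι → Bool)) (f : (ι → Bool) → Bool) (δ : ℝ) : ℕ :=
  RwcTask X (fun x b => b = f x) (fun _ : Bool => True) δ

end WorstCase

section Product

variable {m n : ℕ} {L : Type}

/-- The `i`-th block of an input to the `n`-fold direct product. -/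
def block (x : Fin n × Fin m → Bool) (i : Fin n) : Fin m → Bool := fun j => x (i, j)

/-- The product domain `Xⁿ`. -/
def Xpow (n : ℕ) (X : Set (Fin m → Bool)) : Set (Fin n × Fin m → Bool) :=
  {x | ∀ i, block x i ∈ X}

/-- The `n`-fold direct product `fⁿ`. -/
def fpow (f : (Fin m → Bool) → Bool) (x : Fin n × Fin m → Bool) : Fin n → Bool :=
  fun i => f (block x i)

/-- The product distribution `μⁿ`. -/
noncomputable def prodMu (μ : (Fin m → Bool) → ℝ) (x : Fin n × Fin m → Bool) : ℝ :=
  ∏ i, μ (block x i)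

/-- The `i`-th factor `ℓ^(i)` of the (product) leaf reached by `x` in a decision tree for `fⁿ`. -/
def blockSet (t : DTree (Fin n × Fin m) L) (x : Fin n × Fin m → Bool) (i : Fin n) :
    Set (Fin m → Bool) :=
  {y | (fun q : Fin n × Fin m => if q.1 = i then y q.2 else x q) ∈ t.leafSet x}

/-- Score of a leaf of a tree for `fⁿ` under `μⁿ`: the product of the scores of its factors. -/
noncomputable def prodLeafScore (S : ScoreFun) (f : (Fin m → Bool) → Bool)
    (μ : (Fin m → Bool) → ℝ) (t : DTree (Fin n × Fin m) L) (x : Fin n × Fin m → Bool) : ℝ :=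
  ∏ i, S.φ (mass μ (blockSet t x i ∩ {y | f y = true}) / mass μ (blockSet t x i))

/-- Score of a randomized algorithm for `fⁿ` under `μⁿ`. -/
noncomputable def algScoreN (S : ScoreFun) (f : (Fin m → Bool) → Bool)
    (μ : (Fin m → Bool) → ℝ) (R : RandAlg (Fin n × Fin m) L) : ℝ :=
  ∑ j, R.p j * ∑ x, prodMu μ x * prodLeafScore S f μ (R.T j) x

/-- Score-weighted cost of a randomized algorithm for `fⁿ` under `μⁿ`. -/
noncomputable def scostN (S : ScoreFun) (f : (Fin m → Bool) → Bool)
    (μ : (Fin m → Bool) → ℝ) (R : RandAlg (Fin n × Fin m) L) : ℝ :=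
  (∑ j, R.p j * ∑ x, prodMu μ x * (prodLeafScore S f μ (R.T j) x * ((R.T j).cost x : ℝ))) /
    algScoreN S f μ R

/-- Discounted score of a randomized algorithm for `fⁿ` under `μⁿ`. -/
noncomputable def dScoreN (S : ScoreFun) (f : (Fin m → Bool) → Bool)
    (μ : (Fin m → Bool) → ℝ) (α : ℝ) (R : RandAlg (Fin n × Fin m) L) : ℝ :=
  ∑ j, R.p j * ∑ x, prodMu μ x *
    (prodLeafScore S f μ (R.T j) x * Real.exp (-(α * ((R.T j).cost x : ℝ))))

/-- Maximum discounted score `DS_α^{μⁿ}(fⁿ)`. -/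
noncomputable def DSN (S : ScoreFun) (f : (Fin m → Bool) → Bool)
    (μ : (Fin m → Bool) → ℝ) (α : ℝ) (n : ℕ) : ℝ :=
  ⨆ R : RandAlg (Fin n × Fin m) Unit, dScoreN S f μ α R

/-- Distributional score-weighted query complexity `sR̄̄_γ^{μⁿ}(fⁿ)`. -/
noncomputable def sRdistN (S : ScoreFun) (f : (Fin m → Bool) → Bool)
    (μ : (Fin m → Bool) → ℝ) (γ : ℝ) (n : ℕ) : ℝ :=
  sInf {c | ∃ R : RandAlg (Fin n × Fin m) Unit,
    γ ≤ algScoreN S f μ R ∧ scostN S f μ R = c}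

/-- Worst-case randomized query complexity `R_δ(fⁿ)` of computing `fⁿ` exactly. -/
noncomputable def RwcN (X : Set (Fin m → Bool)) (f : (Fin m → Bool) → Bool)
    (n : ℕ) (δ : ℝ) : ℕ :=
  RwcTask (Xpow n X) (fun x z => z = fpow f x) (fun _ : Fin n → Bool => True) δ

/-- Success-probability score `max_z μ(ℓ ∩ (fⁿ)⁻¹(z))/μ(ℓ)` of a leaf of a tree for `fⁿ`
under an arbitrary distribution `μ` on `Xⁿ`. -/
noncomputable def succLeafScoreN (f : (Fin m → Bool) → Bool)
    (μ : (Fin n × Fin m → Bool) → ℝ) (t : DTree (Fin n × Fin m) L)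
    (x : Fin n × Fin m → Bool) : ℝ :=
  (⨆ z : Fin n → Bool, mass μ (t.leafSet x ∩ {y | fpow f y = z})) / mass μ (t.leafSet x)

/-- Success-probability score of a randomized algorithm for `fⁿ`. -/
noncomputable def succAlgScoreN (f : (Fin m → Bool) → Bool)
    (μ : (Fin n × Fin m → Bool) → ℝ) (R : RandAlg (Fin n × Fin m) L) : ℝ :=
  ∑ j, R.p j * ∑ x, μ x * succLeafScoreN f μ (R.T j) x

/-- Score-weighted cost of a randomized algorithm for `fⁿ` (success-probability score). -/
noncomputable def succScostN (f : (Fin m → Bool) → Bool)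
    (μ : (Fin n × Fin m → Bool) → ℝ) (R : RandAlg (Fin n × Fin m) L) : ℝ :=
  (∑ j, R.p j * ∑ x, μ x * (succLeafScoreN f μ (R.T j) x * ((R.T j).cost x : ℝ))) /
    succAlgScoreN f μ R

/-- Maximum score-weighted distributional query complexity `sR̄̄_δ(fⁿ)`
(success-probability score). -/
noncomputable def succSRmaxN (X : Set (Fin m → Bool)) (f : (Fin m → Bool) → Bool)
    (n : ℕ) (δ : ℝ) : ℝ :=
  ⨆ μ : InputDist (Fin n × Fin m) (Xpow n X),
    sInf {c | ∃ R : RandAlg (Fin n × Fin m) Unit,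
      δ ≤ succAlgScoreN f μ.μ R ∧ succScostN f μ.μ R = c}

/-- Worst-case randomized query complexity of the list-decoding task `LD_ℓⁿ ∘ f`. -/
noncomputable def RwcLD (X : Set (Fin m → Bool)) (f : (Fin m → Bool) → Bool)
    (n ℓ : ℕ) (δ : ℝ) : ℕ :=
  RwcTask (Xpow n X) (fun x S => fpow f x ∈ S)
    (fun S : Finset (Fin n → Bool) => S.card = 2 ^ (n - ℓ)) δ

open Classical in
/-- Worst-case randomized query complexity of the threshold task `Thr_kⁿ ∘ f`. -/
noncomputable def RwcThr (X : Set (Fin m → Bool)) (f : (Fin m → Bool) → Bool)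
    (n k : ℕ) (δ : ℝ) : ℕ :=
  RwcTask (Xpow n X)
    (fun x z => k ≤ (Finset.univ.filter fun i => z i = fpow f x i).card)
    (fun _ : Fin n → Bool => True) δ

open Classical in
/-- Worst-case randomized query complexity of the labelled threshold task `Label_kⁿ ∘ f`. -/
noncomputable def RwcLabel (X : Set (Fin m → Bool)) (f : (Fin m → Bool) → Bool)
    (n k : ℕ) (δ : ℝ) : ℕ :=
  RwcTask (Xpow n X)
    (fun x z => ∀ i b, z i = some b → fpow f x i = b)
    (fun z : Fin n → Option Bool =>
      (Finset.univ.filter fun i => (z i).isSome).card = k) δ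

end Product

namespace DTree

variable {ι L L' : Type}

theorem allLabels_true (t : DTree ι L) : t.allLabels (fun _ => True) := by
  induction t with
  | leaf _ => trivial
  | node _ _ _ h0 h1 => exact ⟨h0, h1⟩

/-- Relabel the leaves of a decision tree. -/
def mapLabel (g : L → L') : DTree ι L → DTree ι L'
  | leaf l => leaf (g l)
  | node i t0 t1 => node i (mapLabel g t0) (mapLabel g t1)

theorem out_mapLabel (g : L → L') (t : DTree ι L) (x : ι → Bool) :
    (t.mapLabel g).out x = g (t.out x) := by
  induction t with
  | leaf _ => rfl
  | node i t0 t1 h0 h1 => cases h : x i <;> simp [mapLabel, out, h, h0, h1]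

theorem depth_mapLabel (g : L → L') (t : DTree ι L) : (t.mapLabel g).depth = t.depth := by
  induction t with
  | leaf _ => rfl
  | node i t0 t1 h0 h1 => simp [mapLabel, depth, h0, h1]

/-- Querying every coordinate computes an arbitrary function. -/
theorem exists_out_eq [Fintype ι] [DecidableEq ι] (g : (ι → Bool) → L) :
    ∃ t : DTree ι L, ∀ x, t.out x = g x := by
  suffices H : ∀ (s : Finset ι) (g : (ι → Bool) → L),
      (∀ x y, (∀ i ∈ s, x i = y i) → g x = g y) → ∃ t : DTree ι L, ∀ x, t.out x = g x from
    H Finset.univ g fun x y h => congrArg g (funext fun i => h i (Finset.mem_univ i))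
  intro s
  induction s using Finset.induction_on with
  | empty => exact fun g hg => ⟨leaf (g fun _ => false), fun x => hg _ _ (by simp)⟩
  | insert a s _ ih =>
    intro g hg
    have key (b : Bool) : ∃ t : DTree ι L, ∀ x, t.out x = g (Function.update x a b) := by
      refine ih _ fun x y h => hg _ _ fun i hi => ?_
      by_cases hia : i = a
      · simp [hia]
      · simpa [hia] using h i ((Finset.mem_insert.1 hi).resolve_left hia)
    obtain ⟨t0, h0⟩ := key false
    obtain ⟨t1, h1⟩ := key true
    refine ⟨node a t0 t1, fun x => ?_⟩
    cases h : x a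
    · simp only [out, h, h0, Bool.false_eq_true, if_false]
      rw [← h, Function.update_eq_self]
    · simp only [out, h, h1, if_true]
      rw [← h, Function.update_eq_self]

end DTree

section Restrict

variable {ι : Type}

/-- Restriction of a weight function to the inputs with `x j = b`. -/
def restrictWeight (ν : (ι → Bool) → ℝ) (j : ι) (b : Bool) : (ι → Bool) → ℝ :=
  fun x => if x j = b then ν x else 0

theorem restrictWeight_nonneg {ν : (ι → Bool) → ℝ} (hν : ∀ x, 0 ≤ ν x) (j : ι) (b : Bool)
    (x : ι → Bool) : 0 ≤ restrictWeight ν j b x := by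
  unfold restrictWeight
  split_ifs
  exacts [hν x, le_rfl]

variable [Fintype ι] [DecidableEq ι]

/-- Weight of the inputs with `f x = b`. -/
def classWeight (f : (ι → Bool) → Bool) (ν : (ι → Bool) → ℝ) (b : Bool) : ℝ :=
  ∑ x, if f x = b then ν x else 0

/-- The normalised `ℓ²` norm of the pair of class weights. -/
noncomputable def l2Score (f : (ι → Bool) → Bool) (ν : (ι → Bool) → ℝ) : ℝ :=
  √(2 * (classWeight f ν true ^ 2 + classWeight f ν false ^ 2))

/-- Discounted total `l2Score` of the leaves of a decision tree. -/
noncomputable def DTree.l2Value {L : Type} (f : (ι → Bool) → Bool) (θ : ℝ) :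
    DTree ι L → ((ι → Bool) → ℝ) → ℝ
  | .leaf _, ν => l2Score f ν
  | .node j t0 t1, ν =>
    θ * (l2Value f θ t0 (restrictWeight ν j false) + l2Value f θ t1 (restrictWeight ν j true))

theorem sum_restrictWeight_mul (ν g₀ g₁ : (ι → Bool) → ℝ) (j : ι) :
    ∑ x, restrictWeight ν j false x * g₀ x + ∑ x, restrictWeight ν j true x * g₁ x =
      ∑ x, ν x * (if x j then g₁ x else g₀ x) := by
  rw [← Finset.sum_add_distrib]
  refine Finset.sum_congr rfl fun x _ => ?_
  cases h : x j <;> simp [restrictWeight, h]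

theorem sum_restrictWeight (ν : (ι → Bool) → ℝ) (j : ι) :
    ∑ x, restrictWeight ν j false x + ∑ x, restrictWeight ν j true x = ∑ x, ν x := by
  simpa using sum_restrictWeight_mul ν 1 1 j

theorem classWeight_nonneg (f : (ι → Bool) → Bool) {ν : (ι → Bool) → ℝ} (hν : ∀ x, 0 ≤ ν x)
    (b : Bool) : 0 ≤ classWeight f ν b := by
  refine Finset.sum_nonneg fun x _ => ?_
  split_ifs
  exacts [hν x, le_rfl]

theorem classWeight_add (f : (ι → Bool) → Bool) (ν : (ι → Bool) → ℝ) :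
    classWeight f ν true + classWeight f ν false = ∑ x, ν x := by
  rw [classWeight, classWeight, ← Finset.sum_add_distrib]
  refine Finset.sum_congr rfl fun x _ => ?_
  cases f x <;> simp

theorem l2Score_nonneg (f : (ι → Bool) → Bool) (ν : (ι → Bool) → ℝ) : 0 ≤ l2Score f ν :=
  Real.sqrt_nonneg _

theorem l2Score_le (f : (ι → Bool) → Bool) {ν : (ι → Bool) → ℝ} (hν : ∀ x, 0 ≤ ν x) :
    l2Score f ν ≤ 2 * ∑ x, ν x := by
  have h1 := classWeight_nonneg f hν true
  have h0 := classWeight_nonneg f hν false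
  rw [← classWeight_add f ν]
  refine Real.sqrt_le_iff.2 ⟨by positivity, ?_⟩
  nlinarith [mul_nonneg h1 h0, sq_nonneg (classWeight f ν true), sq_nonneg (classWeight f ν false)]

theorem DTree.l2Value_nonneg {L : Type} (f : (ι → Bool) → Bool) {θ : ℝ} (hθ : 0 ≤ θ)
    (t : DTree ι L) (ν : (ι → Bool) → ℝ) : 0 ≤ t.l2Value f θ ν := by
  induction t generalizing ν with
  | leaf _ => exact l2Score_nonneg f ν
  | node j t0 t1 h0 h1 => exact mul_nonneg hθ (add_nonneg (h0 _) (h1 _))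

theorem DTree.l2Value_le {L : Type} (f : (ι → Bool) → Bool) {θ : ℝ} (hθ : 0 ≤ θ) (hθ1 : θ ≤ 1)
    (t : DTree ι L) {ν : (ι → Bool) → ℝ} (hν : ∀ x, 0 ≤ ν x) :
    t.l2Value f θ ν ≤ 2 * ∑ x, ν x := by
  induction t generalizing ν with
  | leaf _ => exact l2Score_le f hν
  | node j t0 t1 h0 h1 =>
    have := add_le_add (h0 (restrictWeight_nonneg hν j false)) (h1 (restrictWeight_nonneg hν j true))
    rw [← mul_add, sum_restrictWeight] at this
    exact (mul_le_of_le_one_left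
      (add_nonneg (t0.l2Value_nonneg f hθ _) (t1.l2Value_nonneg f hθ _)) hθ1).trans this

/-- The largest discounted `l2Value` over all decision trees. -/
noncomputable def maxL2Value (f : (ι → Bool) → Bool) (θ : ℝ) (ν : (ι → Bool) → ℝ) : ℝ :=
  ⨆ t : DTree ι Unit, t.l2Value f θ ν

theorem l2Value_le_maxL2Value (f : (ι → Bool) → Bool) {θ : ℝ} (hθ : 0 ≤ θ) (hθ1 : θ ≤ 1)
    {ν : (ι → Bool) → ℝ} (hν : ∀ x, 0 ≤ ν x) (t : DTree ι Unit) :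
    t.l2Value f θ ν ≤ maxL2Value f θ ν :=
  le_ciSup (f := fun t : DTree ι Unit => t.l2Value f θ ν)
    ⟨2 * ∑ x, ν x, by rintro _ ⟨t, rfl⟩; exact t.l2Value_le f hθ hθ1 hν⟩ t

theorem l2Score_le_maxL2Value (f : (ι → Bool) → Bool) {θ : ℝ} (hθ : 0 ≤ θ) (hθ1 : θ ≤ 1)
    {ν : (ι → Bool) → ℝ} (hν : ∀ x, 0 ≤ ν x) : l2Score f ν ≤ maxL2Value f θ ν :=
  l2Value_le_maxL2Value f hθ hθ1 hν (.leaf ())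

theorem maxL2Value_restrict_le (f : (ι → Bool) → Bool) {θ : ℝ} (hθ : 0 < θ) (hθ1 : θ ≤ 1)
    {ν : (ι → Bool) → ℝ} (hν : ∀ x, 0 ≤ ν x) (j : ι) :
    θ * (maxL2Value f θ (restrictWeight ν j false) + maxL2Value f θ (restrictWeight ν j true)) ≤
      maxL2Value f θ ν := by
  have : Nonempty (DTree ι Unit) := ⟨.leaf ()⟩
  rw [← le_div_iff₀' hθ, ← le_sub_iff_add_le]
  refine ciSup_le fun t0 => ?_
  rw [le_sub_comm]
  refine ciSup_le fun t1 => ?_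
  rw [le_sub_iff_add_le', le_div_iff₀' hθ]
  exact l2Value_le_maxL2Value f hθ.le hθ1 hν (.node j t0 t1)

end Restrict

section Product

/-- Number of vectors agreeing with `z` in at least `k` coordinates. -/
theorem card_agree_le {n k : ℕ} (z : Fin n → Bool) :
    ((Finset.univ.filter fun z' : Fin n → Bool =>
      k ≤ (Finset.univ.filter fun i => z i = z' i).card).card : ℝ) ≤
      ∑ i ∈ Finset.range (n - k + 1), (n.choose i : ℝ) := by
  have hcard (i : ℕ) : (Finset.powersetCard i (Finset.univ : Finset (Fin n))).card = n.choose i := by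
    simp
  simp_rw [← hcard]
  norm_cast
  refine le_trans ?_ Finset.card_biUnion_le
  refine Finset.card_le_card_of_injOn (fun z' => Finset.univ.filter fun i => z i ≠ z' i) ?_ ?_
  · intro z' hz'
    have hz : k ≤ (Finset.univ.filter fun i => z i = z' i).card := by simpa using hz'
    have hsum := Finset.card_filter_add_card_filter_not (s := (Finset.univ : Finset (Fin n)))
      (fun i => z i = z' i)
    rw [Finset.card_univ, Fintype.card_fin] at hsum
    simp only [Finset.coe_biUnion, Set.mem_iUnion, Finset.mem_coe, Finset.mem_powersetCard,
      Finset.mem_range]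
    refine ⟨_, ?_, Finset.subset_univ _, rfl⟩
    simp only [ne_eq]
    omega
  · intro a _ b _ hab
    funext i
    have := congrArg (i ∈ ·) hab
    simp only [ne_eq, Finset.mem_filter, Finset.mem_univ, true_and, eq_iff_iff] at this
    revert this
    cases z i <;> cases a i <;> cases b i <;> simp

variable {m n : ℕ}

theorem sum_prod_block (ν : Fin n → (Fin m → Bool) → ℝ) :
    ∑ x : Fin n × Fin m → Bool, ∏ i, ν i (block x i) = ∏ i, ∑ y, ν i y := by
  rw [Finset.prod_univ_sum, Fintype.piFinset_univ]
  exact Fintype.sum_equiv (Equiv.curry (Fin n) (Fin m) Bool) _ _ fun x => rfl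

theorem sum_prod_block_ite (f : (Fin m → Bool) → Bool) (ν : Fin n → (Fin m → Bool) → ℝ)
    (P : (Fin n → Bool) → Prop) [DecidablePred P] :
    ∑ x : Fin n × Fin m → Bool, (if P (fpow f x) then ∏ i, ν i (block x i) else 0) =
      ∑ z with P z, ∏ i, classWeight f (ν i) (z i) := by
  have h (z : Fin n → Bool) : ∏ i, classWeight f (ν i) (z i) =
      ∑ x : Fin n × Fin m → Bool, if fpow f x = z then ∏ i, ν i (block x i) else 0 := by
    simp only [classWeight]
    rw [← sum_prod_block fun i y => if f y = z i then ν i y else 0]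
    refine Finset.sum_congr rfl fun x _ => ?_
    split_ifs with hz
    · exact Finset.prod_congr rfl fun i _ => if_pos (congrFun hz i)
    · obtain ⟨i, hi⟩ := Function.ne_iff.1 hz
      exact Finset.prod_eq_zero (Finset.mem_univ i) (if_neg hi)
  simp_rw [h]
  rw [Finset.sum_comm]
  refine Finset.sum_congr rfl fun x _ => ?_
  rw [Finset.sum_ite_eq]
  simp

/-- Weight of the inputs agreeing with a fixed vector in at least `k` coordinates. -/
theorem agree_weight_le (f : (Fin m → Bool) → Bool) (ν : Fin n → (Fin m → Bool) → ℝ) (k : ℕ)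
    (z : Fin n → Bool) :
    ∑ x : Fin n × Fin m → Bool, (if k ≤ (Finset.univ.filter fun i => z i = fpow f x i).card then
        ∏ i, ν i (block x i) else 0) ≤
      √((∑ i ∈ Finset.range (n - k + 1), (n.choose i : ℝ)) / 2 ^ n) * ∏ i, l2Score f (ν i) := by
  rw [sum_prod_block_ite f ν fun z' => k ≤ (Finset.univ.filter fun i => z i = z' i).card]
  set S := Finset.univ.filter fun z' : Fin n → Bool =>
    k ≤ (Finset.univ.filter fun i => z i = z' i).card
  have hS := card_agree_le (k := k) z
  set V := ∑ i ∈ Finset.range (n - k + 1), (n.choose i : ℝ)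
  have hsq : ∏ i, l2Score f (ν i) =
      √(2 ^ n * ∑ z' : Fin n → Bool, (∏ i, classWeight f (ν i) (z' i)) ^ 2) := by
    have : (2 : ℝ) ^ n * ∑ z' : Fin n → Bool, (∏ i, classWeight f (ν i) (z' i)) ^ 2 =
        ∏ i, (2 * (classWeight f (ν i) true ^ 2 + classWeight f (ν i) false ^ 2)) := by
      rw [Finset.prod_mul_distrib, Finset.prod_const, Finset.card_univ, Fintype.card_fin]
      have hb (i : Fin n) : classWeight f (ν i) true ^ 2 + classWeight f (ν i) false ^ 2 =
          ∑ b, classWeight f (ν i) b ^ 2 := by simp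
      simp_rw [hb, ← Finset.prod_pow]
      rw [Finset.prod_univ_sum, Fintype.piFinset_univ]
    rw [this, Real.sqrt_prod _ fun i _ => by positivity]
    rfl
  rw [hsq, ← Real.sqrt_mul (by positivity)]
  refine Real.le_sqrt_of_sq_le ?_
  calc (∑ z' ∈ S, ∏ i, classWeight f (ν i) (z' i)) ^ 2
      ≤ S.card * ∑ z' ∈ S, (∏ i, classWeight f (ν i) (z' i)) ^ 2 := sq_sum_le_card_mul_sum_sq
    _ ≤ V * ∑ z' : Fin n → Bool, (∏ i, classWeight f (ν i) (z' i)) ^ 2 := by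
        refine mul_le_mul hS (Finset.sum_le_univ_sum_of_nonneg fun _ => sq_nonneg _)
          (Finset.sum_nonneg fun _ _ => sq_nonneg _) ((Nat.cast_nonneg _).trans hS)
    _ = V / 2 ^ n * (2 ^ n * ∑ z' : Fin n → Bool, (∏ i, classWeight f (ν i) (z' i)) ^ 2) := by
        field_simp

theorem prod_update_restrict_eq (ν : Fin n → (Fin m → Bool) → ℝ) (i : Fin n) (j : Fin m) (b : Bool)
    (x : Fin n × Fin m → Bool) :
    ∏ i', Function.update ν i (restrictWeight (ν i) j b) i' (block x i') =
      if x (i, j) = b then ∏ i', ν i' (block x i') else 0 := by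
  split_ifs with h
  · refine Finset.prod_congr rfl fun i' _ => ?_
    obtain rfl | hi := eq_or_ne i' i
    · simp [restrictWeight, block, h]
    · simp [hi]
  · refine Finset.prod_eq_zero (Finset.mem_univ i) ?_
    simp [restrictWeight, block, h]

/-- A tree for the threshold task succeeds with weight bounded by the product of the maximal
values of the factors. -/
theorem success_weight_le (f : (Fin m → Bool) → Bool) {θ : ℝ} (hθ : 0 < θ) (hθ1 : θ ≤ 1) (k : ℕ)
    (t : DTree (Fin n × Fin m) (Fin n → Bool)) (d : ℕ) (hd : t.depth ≤ d)
    {ν : Fin n → (Fin m → Bool) → ℝ} (hν : ∀ i x, 0 ≤ ν i x) :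
    θ ^ d * ∑ x, (if k ≤ (Finset.univ.filter fun i => t.out x i = fpow f x i).card then
        ∏ i, ν i (block x i) else 0) ≤
      √((∑ i ∈ Finset.range (n - k + 1), (n.choose i : ℝ)) / 2 ^ n) *
        ∏ i, maxL2Value f θ (ν i) := by
  have hG {ν : (Fin m → Bool) → ℝ} (hν : ∀ x, 0 ≤ ν x) : 0 ≤ maxL2Value f θ ν :=
    (l2Score_nonneg f ν).trans (l2Score_le_maxL2Value f hθ.le hθ1 hν)
  induction t generalizing ν d with
  | leaf z =>
    have h := (agree_weight_le f ν k z).trans (mul_le_mul_of_nonneg_left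
      (Finset.prod_le_prod (fun i _ => l2Score_nonneg f (ν i))
        fun i _ => l2Score_le_maxL2Value f hθ.le hθ1 (hν i)) (Real.sqrt_nonneg _))
    refine le_trans (mul_le_of_le_one_left ?_ (pow_le_one₀ hθ.le hθ1)) h
    refine Finset.sum_nonneg fun x _ => ?_
    split_ifs
    exacts [Finset.prod_nonneg fun i _ => hν i _, le_rfl]
  | node p t0 t1 h0 h1 =>
    obtain ⟨i, j⟩ := p
    obtain ⟨d, rfl⟩ : ∃ d', d = d' + 1 := ⟨d - 1, by simp only [DTree.depth] at hd; omega⟩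
    simp only [DTree.depth, add_le_add_iff_right, sup_le_iff] at hd
    have hν' (b : Bool) (i' : Fin n) (x : Fin m → Bool) :
        0 ≤ Function.update ν i (restrictWeight (ν i) j b) i' x := by
      obtain rfl | hi := eq_or_ne i' i
      · simpa using restrictWeight_nonneg (hν i') j b x
      · simpa [hi] using hν i' x
    have h0 := h0 d hd.1 (hν' false)
    have h1 := h1 d hd.2 (hν' true)
    set C := √((∑ i ∈ Finset.range (n - k + 1), (n.choose i : ℝ)) / 2 ^ n)
    have hprod (b : Bool) :
        ∏ i', maxL2Value f θ (Function.update ν i (restrictWeight (ν i) j b) i') =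
          maxL2Value f θ (restrictWeight (ν i) j b) *
            ∏ i' ∈ Finset.univ.erase i, maxL2Value f θ (ν i') := by
      rw [← Finset.mul_prod_erase _ _ (Finset.mem_univ i), Function.update_self]
      congr 1
      exact Finset.prod_congr rfl fun i' hi' => by
        rw [Function.update_of_ne (Finset.ne_of_mem_erase hi')]
    rw [hprod] at h0 h1
    simp only [prod_update_restrict_eq] at h0 h1
    set Q := ∏ i' ∈ Finset.univ.erase i, maxL2Value f θ (ν i')
    have hQ : 0 ≤ Q := Finset.prod_nonneg fun i' _ => hG (hν i')
    have hsplit : ∑ x, (if k ≤ (Finset.univ.filter fun i' =>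
          (DTree.node (i, j) t0 t1).out x i' = fpow f x i').card then
          ∏ i, ν i (block x i) else 0) =
        ∑ x, (if k ≤ (Finset.univ.filter fun i' => t0.out x i' = fpow f x i').card then
          (if x (i, j) = false then ∏ i, ν i (block x i) else 0) else 0) +
        ∑ x, (if k ≤ (Finset.univ.filter fun i' => t1.out x i' = fpow f x i').card then
          (if x (i, j) = true then ∏ i, ν i (block x i) else 0) else 0) := by
      rw [← Finset.sum_add_distrib]
      refine Finset.sum_congr rfl fun x _ => ?_
      cases h : x (i, j) <;> simp [DTree.out, h]
    rw [hsplit, ← Finset.mul_prod_erase _ _ (Finset.mem_univ i), pow_succ']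
    have hm := mul_le_mul_of_nonneg_left (mul_le_mul_of_nonneg_right
      (maxL2Value_restrict_le f hθ hθ1 (hν i) j) hQ) (Real.sqrt_nonneg _ : 0 ≤ C)
    have := mul_le_mul_of_nonneg_left (add_le_add h0 h1) hθ.le
    rw [mul_assoc θ, mul_add (θ ^ d)]
    refine this.trans (le_of_eq_of_le ?_ hm)
    ring

end Product

section Forecast

/-- The exponential loss exponent sign of a forecast on inputs of class `b`. -/
def classSign (b : Bool) : ℝ := if b then -1 else 1

theorem exp_le_quadratic {y : ℝ} (hy0 : 0 ≤ y) (hy : y ≤ 1 / 4) :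
    Real.exp y ≤ 1 + y + y ^ 2 := by
  have := (abs_le.1 (Real.abs_exp_sub_one_sub_id_le (x := y) (by rw [abs_of_nonneg hy0]; linarith))).2
  linarith

theorem exp_add_exp_neg_le_two {y : ℝ} (hy0 : 0 ≤ y) (hy : y ≤ 1 / 4) :
    Real.exp y + Real.exp (-(8 * y)) ≤ 2 := by
  have h1 := exp_le_quadratic hy0 hy
  have h2 : Real.exp (-(8 * y)) ≤ (1 + 8 * y)⁻¹ := by
    rw [Real.exp_neg]
    exact inv_anti₀ (by linarith) (by linarith [Real.add_one_le_exp (8 * y)])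
  have h3 : (1 + 8 * y)⁻¹ ≤ 1 - y - y ^ 2 := by
    rw [inv_le_iff_one_le_mul₀' (by linarith)]
    nlinarith [mul_nonneg hy0 hy0, mul_nonneg (mul_nonneg hy0 hy0) (sub_nonneg.2 hy),
      mul_nonneg hy0 (sub_nonneg.2 hy)]
  linarith

theorem exp_neg_two_le : Real.exp (-2) ≤ 1 / 3 := by
  rw [Real.exp_neg, ← one_div]
  exact one_div_le_one_div_of_le (by norm_num) (by linarith [Real.add_one_le_exp 2])

/-- At every leaf some forecast has small discounted exponential loss. -/
theorem exists_forecast {a b y : ℝ} (ha : 0 ≤ a) (hb : 0 ≤ b) (hy0 : 0 ≤ y) (hy : y ≤ 1 / 4) :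
    ∃ s : ℝ, Real.exp y * (a * Real.exp (-s) + b * Real.exp s) +
      √(2 * (a ^ 2 + b ^ 2)) * Real.exp (-(8 * y)) ≤ 2 * (a + b) := by
  have hE : Real.exp y ≤ 21 / 16 := by
    have := exp_le_quadratic hy0 hy
    nlinarith
  have hE' : Real.exp (-(8 * y)) ≤ 1 := Real.exp_le_one_iff.2 (by linarith)
  have hone (c : ℝ) (hc : 0 ≤ c) : Real.exp y * (c * Real.exp (-2)) +
      √(2 * c ^ 2) * Real.exp (-(8 * y)) ≤ 2 * c := by
    have h1 : √(2 * c ^ 2) ≤ 3 / 2 * c := Real.sqrt_le_iff.2 ⟨by positivity, by nlinarith⟩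
    have h2 : √(2 * c ^ 2) * Real.exp (-(8 * y)) ≤ √(2 * c ^ 2) :=
      mul_le_of_le_one_right (Real.sqrt_nonneg _) hE'
    have h3 : Real.exp y * (c * Real.exp (-2)) ≤ 21 / 16 * (c * (1 / 3)) :=
      mul_le_mul hE (mul_le_mul_of_nonneg_left exp_neg_two_le hc) (by positivity) (by norm_num)
    linarith
  rcases ha.eq_or_lt with rfl | ha'
  · exact ⟨-2, by simpa using hone b hb⟩
  rcases hb.eq_or_lt with rfl | hb'
  · exact ⟨2, by simpa using hone a ha⟩
  refine ⟨Real.log (√a / √b), ?_⟩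
  have hsa := Real.sqrt_pos.2 ha'
  have hsb := Real.sqrt_pos.2 hb'
  rw [Real.exp_neg, Real.exp_log (div_pos hsa hsb)]
  obtain ⟨u, hu⟩ : ∃ u, u = √a := ⟨_, rfl⟩
  obtain ⟨v, hv⟩ : ∃ v, v = √b := ⟨_, rfl⟩
  have hua : a = u ^ 2 := by rw [hu, Real.sq_sqrt ha]
  have hvb : b = v ^ 2 := by rw [hv, Real.sq_sqrt hb]
  rw [← hu] at hsa ⊢
  rw [← hv] at hsb ⊢
  subst hua hvb
  have hP : u ^ 2 * (u / v)⁻¹ + v ^ 2 * (u / v) = 2 * (u * v) := by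
    field_simp
    ring
  rw [hP]
  set Q := √(2 * ((u ^ 2) ^ 2 + (v ^ 2) ^ 2))
  have hQ2 : Q ^ 2 = 2 * ((u ^ 2) ^ 2 + (v ^ 2) ^ 2) := Real.sq_sqrt (by positivity)
  have hQ0 : 0 ≤ Q := Real.sqrt_nonneg _
  have huv := mul_pos hsa hsb
  have hPQ : 2 * (u * v) ≤ Q := by
    refine Real.le_sqrt_of_sq_le ?_
    nlinarith [sq_nonneg (u ^ 2 - v ^ 2), sq_nonneg (u ^ 2 + v ^ 2)]
  have hsum : 2 * (u * v) + Q ≤ 2 * (u ^ 2 + v ^ 2) := by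
    have : (2 * (u * v) + Q) ^ 2 ≤ (2 * (u ^ 2 + v ^ 2)) ^ 2 := by
      nlinarith [sq_nonneg (2 * (u * v) - Q)]
    exact le_of_sq_le_sq this (by positivity)
  have hexp := exp_add_exp_neg_le_two hy0 hy
  have h1 : 1 ≤ Real.exp y := Real.one_le_exp hy0
  nlinarith [mul_nonneg (sub_nonneg.2 hPQ) (sub_nonneg.2 hE'),
    mul_nonneg huv.le (sub_nonneg.2 hexp)]

variable {ι : Type}

/-- Exponential loss, inflated by the cost, of a tree whose leaves are labelled by forecasts. -/
noncomputable def DTree.expLoss (f : (ι → Bool) → Bool) (α : ℝ) (t : DTree ι ℝ) :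
    (ι → Bool) → ℝ :=
  fun x => Real.exp (classSign (f x) * t.out x + α * t.cost x)

theorem DTree.expLoss_leaf (f : (ι → Bool) → Bool) (α s : ℝ) (x : ι → Bool) :
    (DTree.leaf s : DTree ι ℝ).expLoss f α x = Real.exp (classSign (f x) * s) := by
  simp [DTree.expLoss, DTree.out, DTree.cost]

theorem DTree.expLoss_node (f : (ι → Bool) → Bool) (α : ℝ) (j : ι) (t0 t1 : DTree ι ℝ)
    (x : ι → Bool) : (DTree.node j t0 t1).expLoss f α x =
      Real.exp α * (if x j then t1.expLoss f α x else t0.expLoss f α x) := by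
  cases h : x j <;>
    simp only [DTree.expLoss, DTree.out, DTree.cost, h, if_true, if_false, Bool.false_eq_true,
      ← Real.exp_add] <;> push_cast <;> congr 1 <;> ring

variable [Fintype ι] [DecidableEq ι]

theorem sum_mul_expLoss_leaf (f : (ι → Bool) → Bool) (α s : ℝ) (ν : (ι → Bool) → ℝ) :
    ∑ x, ν x * (DTree.leaf s : DTree ι ℝ).expLoss f α x =
      classWeight f ν true * Real.exp (-s) + classWeight f ν false * Real.exp s := by
  rw [classWeight, classWeight, Finset.sum_mul, Finset.sum_mul, ← Finset.sum_add_distrib]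
  refine Finset.sum_congr rfl fun x _ => ?_
  rw [DTree.expLoss_leaf]
  cases f x <;> simp [classSign]

theorem sum_mul_expLoss_node (f : (ι → Bool) → Bool) (α : ℝ) (j : ι) (t0 t1 : DTree ι ℝ)
    (ν : (ι → Bool) → ℝ) : ∑ x, ν x * (DTree.node j t0 t1).expLoss f α x =
      Real.exp α * (∑ x, restrictWeight ν j false x * t0.expLoss f α x +
        ∑ x, restrictWeight ν j true x * t1.expLoss f α x) := by
  rw [sum_restrictWeight_mul, Finset.mul_sum]
  refine Finset.sum_congr rfl fun x _ => ?_
  rw [DTree.expLoss_node]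
  ring

/-- Every tree can be truncated and labelled so that its loss controls its `l2Value`. -/
theorem exists_expLoss_le {L : Type} (f : (ι → Bool) → Bool) {D : ℕ} {α : ℝ}
    (hα : α * (D + 1) = 1 / 4) (t : DTree ι L) (c : ℕ) (hc : c ≤ D) {ν : (ι → Bool) → ℝ}
    (hν : ∀ x, 0 ≤ ν x) :
    ∃ t' : DTree ι ℝ, t'.depth ≤ D - c ∧
      Real.exp (α * c) * ∑ x, ν x * t'.expLoss f α x +
        Real.exp (-(8 * (α * c))) * t.l2Value f (Real.exp (-(8 * α))) ν ≤ 2 * ∑ x, ν x := by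
  have hα0 : 0 ≤ α := by
    by_contra! h
    nlinarith [(Nat.cast_nonneg D : (0 : ℝ) ≤ D)]
  have hθ := (Real.exp_pos (-(8 * α))).le
  have hθ1 : Real.exp (-(8 * α)) ≤ 1 := Real.exp_le_one_iff.2 (by linarith)
  have hy (c : ℕ) (hc : c ≤ D) : α * c ≤ 1 / 4 := by
    have : (c : ℝ) ≤ D := Nat.cast_le.2 hc
    nlinarith
  induction t generalizing ν c with
  | leaf _ =>
    obtain ⟨s, hs⟩ := exists_forecast (classWeight_nonneg f hν true) (classWeight_nonneg f hν false)
      (by positivity : 0 ≤ α * (c : ℝ)) (hy c hc)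
    refine ⟨.leaf s, by simp [DTree.depth], ?_⟩
    rw [sum_mul_expLoss_leaf, ← classWeight_add f ν]
    rw [mul_comm (√_)] at hs
    exact hs
  | node j t0 t1 h0 h1 =>
    rcases hc.lt_or_eq with hc' | rfl
    · obtain ⟨s0, hs0, hl0⟩ := h0 (c + 1) hc' (restrictWeight_nonneg hν j false)
      obtain ⟨s1, hs1, hl1⟩ := h1 (c + 1) hc' (restrictWeight_nonneg hν j true)
      refine ⟨.node j s0 s1, ?_, ?_⟩
      · simp only [DTree.depth]
        omega
      · rw [sum_mul_expLoss_node, DTree.l2Value, ← sum_restrictWeight ν j]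
        have e1 : Real.exp (α * (c + 1 : ℕ)) = Real.exp (α * c) * Real.exp α := by
          rw [← Real.exp_add]; push_cast; ring_nf
        have e2 : Real.exp (-(8 * (α * (c + 1 : ℕ)))) =
            Real.exp (-(8 * (α * c))) * Real.exp (-(8 * α)) := by
          rw [← Real.exp_add]; push_cast; ring_nf
        rw [e1, e2] at hl0 hl1
        refine le_of_eq_of_le ?_ ((add_le_add hl0 hl1).trans_eq (mul_add _ _ _).symm)
        ring
    · refine ⟨.leaf 0, by simp [DTree.depth], ?_⟩
      rw [sum_mul_expLoss_leaf, neg_zero, Real.exp_zero, mul_one, mul_one, classWeight_add,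
        DTree.l2Value]
      have hv0 := t0.l2Value_le f hθ hθ1 (restrictWeight_nonneg hν j false)
      have hv1 := t1.l2Value_le f hθ hθ1 (restrictWeight_nonneg hν j true)
      have hv := add_le_add hv0 hv1
      rw [← mul_add, sum_restrictWeight] at hv
      have hM : 0 ≤ ∑ x, ν x := Finset.sum_nonneg fun x _ => hν x
      have e2 : Real.exp (-(8 * (α * c))) * Real.exp (-(8 * α)) = Real.exp (-2) := by
        rw [← Real.exp_add]; congr 1; linarith
      rw [← mul_assoc, e2]
      have h2 : Real.exp (α * c) ≤ 21 / 16 := by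
        have := exp_le_quadratic (by positivity : 0 ≤ α * (c : ℝ)) (hy c le_rfl)
        nlinarith [hy c le_rfl, (by positivity : 0 ≤ α * (c : ℝ))]
      have h3 := mul_le_mul exp_neg_two_le hv (add_nonneg (t0.l2Value_nonneg f hθ _)
        (t1.l2Value_nonneg f hθ _)) (by norm_num)
      nlinarith [mul_le_mul_of_nonneg_right h2 hM]

/-- A distribution on which shallow forecasting trees have large loss has small `maxL2Value`. -/
theorem maxL2Value_le_one (f : (ι → Bool) → Bool) {D : ℕ} {α : ℝ} (hα : α * (D + 1) = 1 / 4)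
    {ν : (ι → Bool) → ℝ} (hν : ∀ x, 0 ≤ ν x) (hν1 : ∑ x, ν x = 1)
    (hard : ∀ t : DTree ι ℝ, t.depth ≤ D → 1 ≤ ∑ x, ν x * t.expLoss f α x) :
    maxL2Value f (Real.exp (-(8 * α))) ν ≤ 1 := by
  have : Nonempty (DTree ι Unit) := ⟨.leaf ()⟩
  refine ciSup_le fun t => ?_
  obtain ⟨t', ht', h⟩ := exists_expLoss_le f hα t 0 (Nat.zero_le D) hν
  have := hard t' ht'
  simp only [Nat.cast_zero, mul_zero, neg_zero, Real.exp_zero, one_mul, hν1] at h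
  linarith

end Forecast

section Minimax

variable {ι : Type}

/-- Loss vectors of randomized forecasting algorithms of depth at most `d`. -/
def lossHull (f : (ι → Bool) → Bool) (α : ℝ) (d : ℕ) : Set ((ι → Bool) → ℝ) :=
  convexHull ℝ {v | ∃ t : DTree ι ℝ, t.depth ≤ d ∧ t.expLoss f α = v}

theorem expLoss_mem_lossHull (f : (ι → Bool) → Bool) (α : ℝ) {d : ℕ} {t : DTree ι ℝ}
    (ht : t.depth ≤ d) : t.expLoss f α ∈ lossHull f α d :=
  subset_convexHull ℝ _ ⟨t, ht, rfl⟩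

theorem lossHull_node (f : (ι → Bool) → Bool) {d : ℕ} (j : ι) {u0 u1 : (ι → Bool) → ℝ}
    (h0 : u0 ∈ lossHull f 0 d) (h1 : u1 ∈ lossHull f 0 d) :
    (fun x => if x j then u1 x else u0 x) ∈ lossHull f 0 (d + 1) := by
  let F : ((ι → Bool) → ℝ) × ((ι → Bool) → ℝ) →ₗ[ℝ] ((ι → Bool) → ℝ) :=
    { toFun := fun p x => if x j then p.2 x else p.1 x
      map_add' := fun p q => by
        ext x; simp only [Prod.snd_add, Prod.fst_add, Pi.add_apply]; split_ifs <;> rfl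
      map_smul' := fun c p => by
        ext x; simp only [Prod.smul_snd, Prod.smul_fst, Pi.smul_apply, RingHom.id_apply]
        split_ifs <;> rfl }
  have hmem : F (u0, u1) ∈ F '' convexHull ℝ
      ({v | ∃ t : DTree ι ℝ, t.depth ≤ d ∧ t.expLoss f 0 = v} ×ˢ
        {v | ∃ t : DTree ι ℝ, t.depth ≤ d ∧ t.expLoss f 0 = v}) := by
    rw [convexHull_prod]
    exact ⟨(u0, u1), ⟨h0, h1⟩, rfl⟩
  rw [LinearMap.image_convexHull] at hmem
  refine convexHull_mono ?_ hmem
  rintro _ ⟨⟨_, _⟩, ⟨⟨t0, ht0, rfl⟩, ⟨t1, ht1, rfl⟩⟩, rfl⟩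
  refine ⟨.node j t0 t1, by simp [DTree.depth, ht0, ht1], funext fun x => ?_⟩
  simp [DTree.expLoss_node, F]

theorem lossHull_shift (f : (ι → Bool) → Bool) {d : ℕ} (s : ℝ) {u : (ι → Bool) → ℝ}
    (h : u ∈ lossHull f 0 d) :
    (fun x => Real.exp (classSign (f x) * s) * u x) ∈ lossHull f 0 d := by
  let F : ((ι → Bool) → ℝ) →ₗ[ℝ] ((ι → Bool) → ℝ) :=
    LinearMap.mulLeft ℝ (fun x => Real.exp (classSign (f x) * s))
  have hmem : F u ∈ F '' lossHull f 0 d := ⟨u, h, rfl⟩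
  rw [lossHull, LinearMap.image_convexHull] at hmem
  refine convexHull_mono ?_ hmem
  rintro _ ⟨_, ⟨t, ht, rfl⟩, rfl⟩
  refine ⟨t.mapLabel (s + ·), by rwa [DTree.depth_mapLabel], funext fun x => ?_⟩
  simp only [F, LinearMap.mulLeft_apply, Pi.mul_apply, DTree.expLoss, DTree.out_mapLabel, zero_mul,
    add_zero, ← Real.exp_add]
  ring_nf

/-- Continuing a tree at each leaf with a randomized algorithm for the remaining budget. -/
theorem lossHull_bind (f : (ι → Bool) → Bool) {D : ℕ} {w : ℕ → (ι → Bool) → ℝ} (hw0 : w 0 = 1)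
    (hw : ∀ B, w B ∈ lossHull f 0 (B + D)) (t : DTree ι ℝ) (ht : t.depth ≤ D) (B : ℕ) :
    (fun x => Real.exp (classSign (f x) * t.out x) * w (B - t.cost x) x) ∈
      lossHull f 0 (B + D) := by
  induction t generalizing B with
  | leaf s => exact lossHull_shift f s (hw B)
  | node j t0 t1 h0 h1 =>
    cases B with
    | zero =>
      convert expLoss_mem_lossHull f 0 (d := 0 + D) (by simpa using ht) using 1
      ext x
      simp [hw0, DTree.expLoss]
    | succ B =>
      simp only [DTree.depth] at ht
      have := lossHull_node f j (h0 (by omega) B) (h1 (by omega) B)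
      rw [show B + 1 + D = B + D + 1 by omega]
      convert this using 2 with x
      cases h : x j <;> simp [DTree.out, DTree.cost, h]

/-- Repeating a forecasting algorithm whose inflated loss is below one until the budget is
spent. -/
theorem exists_repeated_forecast (f : (ι → Bool) → Bool) (X : Set (ι → Bool)) {D : ℕ} {α q : ℝ}
    (hα : 0 ≤ α) (hq0 : 0 ≤ q) (hq : q ≤ 1) {v : (ι → Bool) → ℝ} (hv : v ∈ lossHull f α D)
    (hvq : ∀ x ∈ X, v x ≤ q) (N : ℕ) :
    ∃ w : ℕ → (ι → Bool) → ℝ, w 0 = 1 ∧ (∀ B, w B ∈ lossHull f 0 (B + D)) ∧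
      ∀ B, ∀ x ∈ X, w B x ≤ Real.exp (-(α * B)) + q ^ N := by
  have hone (d : ℕ) : (1 : (ι → Bool) → ℝ) ∈ lossHull f 0 d := by
    convert expLoss_mem_lossHull f 0 (t := .leaf 0) (d := d) (by simp [DTree.depth]) using 1
    ext x
    simp [DTree.expLoss_leaf]
  induction N with
  | zero =>
    refine ⟨fun _ => 1, rfl, fun B => hone _, fun B x _ => ?_⟩
    have := Real.exp_pos (-(α * B))
    simp only [Pi.one_apply, pow_zero]
    linarith
  | succ N ih =>
    obtain ⟨w, hw0, hw, hwX⟩ := ih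
    have key (B : ℕ) : ∃ u ∈ lossHull f 0 (B + D), ∀ x ∈ X,
        u x ≤ (Real.exp (-(α * B)) + q ^ N) * v x := by
      let C : Set ((ι → Bool) → ℝ) := {v | ∃ u ∈ lossHull f 0 (B + D), ∀ x ∈ X,
        u x ≤ (Real.exp (-(α * B)) + q ^ N) * v x}
      suffices h : lossHull f α D ⊆ C from h hv
      refine convexHull_min ?_ ?_
      · rintro _ ⟨t, ht, rfl⟩
        refine ⟨_, lossHull_bind f hw0 hw t ht B, fun x hx => ?_⟩
        have h1 := mul_le_mul_of_nonneg_left (hwX (B - t.cost x) x hx)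
          (Real.exp_pos (classSign (f x) * t.out x)).le
        refine h1.trans ?_
        rw [DTree.expLoss, Real.exp_add, ← mul_assoc, mul_comm _ (Real.exp (classSign _ * _)),
          mul_assoc]
        refine mul_le_mul_of_nonneg_left ?_ (Real.exp_pos _).le
        rw [add_mul, ← Real.exp_add]
        refine add_le_add (Real.exp_le_exp.2 ?_)
          (le_mul_of_one_le_right (pow_nonneg hq0 N) (Real.one_le_exp (by positivity)))
        have : (B : ℝ) ≤ (B - t.cost x : ℕ) + t.cost x := by norm_cast; omega
        nlinarith
      · rintro v1 ⟨u1, hu1, h1⟩ v2 ⟨u2, hu2, h2⟩ a b ha hb hab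
        refine ⟨a • u1 + b • u2, convex_convexHull ℝ _ hu1 hu2 ha hb hab, fun x hx => ?_⟩
        have e1 := mul_le_mul_of_nonneg_left (h1 x hx) ha
        have e2 := mul_le_mul_of_nonneg_left (h2 x hx) hb
        simp only [Pi.add_apply, Pi.smul_apply, smul_eq_mul]
        linarith
    choose u hu huX using key
    refine ⟨fun B => if B = 0 then 1 else u B, rfl, fun B => ?_, fun B x hx => ?_⟩
    · dsimp only
      split_ifs
      exacts [hone _, hu B]
    · dsimp only
      split_ifs with hB
      · simp only [hB, Pi.one_apply, Nat.cast_zero, mul_zero, neg_zero, Real.exp_zero]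
        linarith [pow_nonneg hq0 (N + 1)]
      · have hE := Real.exp_pos (-(α * B))
        have hp := pow_nonneg hq0 N
        calc u B x ≤ (Real.exp (-(α * B)) + q ^ N) * v x := huX B x hx
          _ ≤ (Real.exp (-(α * B)) + q ^ N) * q :=
            mul_le_mul_of_nonneg_left (hvq x hx) (by positivity)
          _ ≤ Real.exp (-(α * B)) + q ^ (N + 1) := by
            rw [pow_succ]
            nlinarith

/-- Thresholding the forecasts of a randomized algorithm with small loss. -/
theorem Rwc_le_of_mem_lossHull (f : (ι → Bool) → Bool) (X : Set (ι → Bool)) {d : ℕ}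
    {v : (ι → Bool) → ℝ} (hv : v ∈ lossHull f 0 d) (hX : ∀ x ∈ X, v x ≤ 1 / 3) :
    Rwc X f (2 / 3) ≤ d := by
  classical
  obtain ⟨κ, _, p, z, hp, hp1, hz, hsum⟩ := mem_convexHull_iff_exists_fintype.1 hv
  choose t ht htz using hz
  let e := Fintype.equivFin κ
  let R : RandAlg ι Bool :=
    { k := Fintype.card κ
      p := fun j => p (e.symm j)
      T := fun j => (t (e.symm j)).mapLabel fun s => decide (0 ≤ s)
      p_nonneg := fun j => hp _
      p_sum := by rw [← hp1]; exact Equiv.sum_comp e.symm p }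
  refine Nat.sInf_le ⟨R, fun _ _ => DTree.allLabels_true _, fun x hx => ?_, fun j _ => ?_⟩
  · have hR : ∑ j, (if (R.T j).out x = f x then R.p j else 0) =
        ∑ i, if decide (0 ≤ (t i).out x) = f x then p i else 0 := by
      simp only [R, DTree.out_mapLabel]
      exact Equiv.sum_comp e.symm fun i => if decide (0 ≤ (t i).out x) = f x then p i else 0
    have hi (i : κ) : p i ≤ p i * z i x + if decide (0 ≤ (t i).out x) = f x then p i else 0 := by
      have hz0 : 0 ≤ z i x := by rw [← htz i]; exact (Real.exp_pos _).le
      split_ifs with h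
      · linarith [mul_nonneg (hp i) hz0]
      · rw [add_zero]
        refine le_mul_of_one_le_right (hp i) ?_
        rw [← htz i, DTree.expLoss, zero_mul, add_zero]
        refine Real.one_le_exp ?_
        cases hf : f x <;> simp [hf, classSign] at h ⊢ <;> linarith
    have hvx : v x = ∑ i, p i * z i x := by simp [← hsum, Finset.sum_apply]
    have := Finset.sum_le_sum fun i (_ : i ∈ Finset.univ) => hi i
    rw [hp1, Finset.sum_add_distrib, ← hvx] at this
    have := hX x hx
    convert (by linarith : (2 / 3 : ℝ) ≤
      ∑ i, if decide (0 ≤ (t i).out x) = f x then p i else 0) using 1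
    rw [← hR]
    refine Finset.sum_congr rfl fun j _ => ?_
    congr
  · simpa [R, DTree.depth_mapLabel] using ht _

variable [Fintype ι] [DecidableEq ι]

/-- Minimax alternative: a hard distribution, or a randomized forecasting algorithm with loss below
one on the whole domain. -/
theorem exists_hard_or_forecast (f : (ι → Bool) → Bool) (X : Set (ι → Bool)) (α : ℝ) (D : ℕ) :
    (∃ μ : InputDist ι X, ∀ t : DTree ι ℝ, t.depth ≤ D → 1 ≤ ∑ x, μ.μ x * t.expLoss f α x) ∨
      ∃ v ∈ lossHull f α D, ∀ x ∈ X, v x < 1 := by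
  by_cases hdis : Disjoint {v : (ι → Bool) → ℝ | ∀ x ∈ X, v x < 1} (lossHull f α D)
  swap
  · obtain ⟨v, hvX, hv⟩ := Set.not_disjoint_iff.1 hdis
    exact Or.inr ⟨v, hv, hvX⟩
  left
  have hconv : Convex ℝ {v : (ι → Bool) → ℝ | ∀ x ∈ X, v x < 1} := by
    intro v hv w hw a b ha hb hab x hx
    exact convex_Iio (1 : ℝ) (hv x hx) (hw x hx) ha hb hab
  have hopen : IsOpen {v : (ι → Bool) → ℝ | ∀ x ∈ X, v x < 1} := by
    simp only [Set.ofPred_forall]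
    exact (Set.toFinite X).isOpen_biInter fun x _ => isOpen_lt (continuous_apply x) continuous_const
  obtain ⟨F, u, hF, hK⟩ := geometric_hahn_banach_open hconv hopen (convex_convexHull ℝ _) hdis
  set c : (ι → Bool) → ℝ := fun x => F (Pi.single x 1)
  have hFc (v : (ι → Bool) → ℝ) : F v = ∑ x, c x * v x := by
    conv_lhs => rw [← Finset.univ_sum_single v]
    rw [map_sum]
    refine Finset.sum_congr rfl fun x _ => ?_
    rw [mul_comm, ← smul_eq_mul, ← map_smul, ← Pi.single_smul, smul_eq_mul, mul_one]
  have hu0 : 0 < u := by simpa using hF 0 (by intro x _; simp)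
  have hline (x : ι → Bool) (s : ℝ)
      (hs : ∀ r : ℝ, 0 ≤ r → (Pi.single x (r * s) : (ι → Bool) → ℝ) ∈
        {v : (ι → Bool) → ℝ | ∀ x ∈ X, v x < 1}) : s * c x ≤ 0 := by
    by_contra! h
    have := hF _ (hs (u / (s * c x)) (by positivity))
    rw [show (Pi.single x (u / (s * c x) * s) : (ι → Bool) → ℝ) =
      (u / (s * c x) * s) • Pi.single x 1 by rw [← Pi.single_smul, smul_eq_mul, mul_one],
      map_smul, smul_eq_mul, mul_assoc, div_mul_cancel₀ _ h.ne'] at this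
    exact lt_irrefl _ this
  have hc0 (x : ι → Bool) : 0 ≤ c x := by
    have := hline x (-1) fun r hr y _ => by
      obtain rfl | hy := eq_or_ne y x
      · simp only [Pi.single_eq_same]; linarith
      · simp [hy]
    linarith
  have hcX (x : ι → Bool) (hx : x ∉ X) : c x = 0 := by
    have := hline x 1 fun r hr y hyX => by
      have hy : y ≠ x := fun h => hx (h ▸ hyX)
      simp [hy]
    exact le_antisymm (by linarith) (hc0 x)
  have hsum : ∑ x, c x ≤ u := by
    by_contra! h
    have hpos := hu0.trans h
    have := hF (fun _ => u / ∑ x, c x) fun x _ => (div_lt_one hpos).2 h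
    rw [hFc, ← Finset.sum_mul, mul_div_cancel₀ _ hpos.ne'] at this
    exact lt_irrefl _ this
  have hpos : 0 < ∑ x, c x := by
    have := hK _ (expLoss_mem_lossHull f α (t := .leaf 0) (by simp [DTree.depth]))
    rw [hFc] at this
    simp only [DTree.expLoss_leaf, mul_zero, Real.exp_zero, mul_one] at this
    linarith
  refine ⟨⟨fun x => c x / ∑ x, c x, fun x => div_nonneg (hc0 x) hpos.le, ?_, fun x hx => ?_⟩,
    fun t ht => ?_⟩
  · rw [← Finset.sum_div, div_self hpos.ne']
  · simp [hcX x hx]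
  · have := hK _ (expLoss_mem_lossHull f α ht)
    rw [hFc] at this
    simp only [div_mul_eq_mul_div, ← Finset.sum_div]
    rw [le_div_iff₀ hpos]
    linarith

/-- If randomized complexity is large then a hard distribution exists. -/
theorem exists_hard_of_lt_Rwc (f : (ι → Bool) → Bool) (X : Set (ι → Bool)) {α : ℝ} {D : ℕ}
    (hα : α * (D + 1) = 1 / 4) (h : 8 * (D + 1) + D < Rwc X f (2 / 3)) :
    ∃ μ : InputDist ι X, ∀ t : DTree ι ℝ, t.depth ≤ D → 1 ≤ ∑ x, μ.μ x * t.expLoss f α x := by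
  refine (exists_hard_or_forecast f X α D).resolve_right ?_
  rintro ⟨v, hv, hvX⟩
  have hα0 : 0 ≤ α := by
    by_contra! h
    nlinarith [(Nat.cast_nonneg D : (0 : ℝ) ≤ D)]
  obtain ⟨q, hq0, hq1, hq⟩ : ∃ q : ℝ, 0 ≤ q ∧ q < 1 ∧ ∀ x ∈ X, v x ≤ q := by
    obtain rfl | hne := X.eq_empty_or_nonempty
    · exact ⟨0, le_rfl, one_pos, by simp⟩
    · obtain ⟨x₀, hx₀, hmax⟩ := Set.exists_max_image X v X.toFinite hne
      exact ⟨max 0 (v x₀), le_max_left _ _, max_lt one_pos (hvX x₀ hx₀),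
        fun x hx => (hmax x hx).trans (le_max_right _ _)⟩
  obtain ⟨N, hN⟩ := exists_pow_lt_of_lt_one (by norm_num : (0 : ℝ) < 1 / 6) hq1
  obtain ⟨w, -, hw, hwX⟩ := exists_repeated_forecast f X hα0 hq0 hq1.le hv hq N
  refine h.not_ge (Rwc_le_of_mem_lossHull f X (hw (8 * (D + 1))) fun x hx => ?_)
  have := hwX (8 * (D + 1)) x hx
  have e : α * (8 * (D + 1) : ℕ) = 2 := by push_cast; linarith
  rw [e] at this
  have h6 : Real.exp (-2) ≤ 1 / 6 := by
    rw [Real.exp_neg, ← one_div]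
    refine one_div_le_one_div_of_le (by norm_num) ?_
    have := Real.exp_one_gt_d9
    rw [show (2 : ℝ) = 1 + 1 by norm_num, Real.exp_add]
    nlinarith
  linarith

end Minimax

section Threshold

theorem Rwc_eq_zero_of_const {ι : Type} (f : (ι → Bool) → Bool) (X : Set (ι → Bool)) (b : Bool)
    (h : ∀ x ∈ X, f x = b) : Rwc X f (2 / 3) = 0 := by
  refine Nat.le_zero.1 (Nat.sInf_le ⟨⟨1, fun _ => 1, fun _ => .leaf b, by simp, by simp⟩,
    fun _ _ => DTree.allLabels_true _, fun x hx => ?_, by simp [DTree.depth]⟩)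
  have hb : b = f x := (h x hx).symm
  refine le_of_le_of_eq ?_ (Finset.sum_congr rfl fun _ _ => if_pos hb).symm
  norm_num

/-- A nonconstant function has a distribution that is hard for queryless forecasts. -/
theorem exists_hard_of_nonconst {ι : Type} [Fintype ι] [DecidableEq ι] (f : (ι → Bool) → Bool)
    (X : Set (ι → Bool)) (α : ℝ) (h : 0 < Rwc X f (2 / 3)) :
    ∃ μ : InputDist ι X, ∀ t : DTree ι ℝ, t.depth ≤ 0 → 1 ≤ ∑ x, μ.μ x * t.expLoss f α x := by
  have hex (b : Bool) : ∃ x ∈ X, f x = !b := by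
    by_contra! hb
    exact h.ne' (Rwc_eq_zero_of_const f X b fun x hx => Bool.not_eq_not.1 (hb x hx))
  obtain ⟨x₀, hx₀, h₀⟩ := hex true
  obtain ⟨x₁, hx₁, h₁⟩ := hex false
  have hsum (g : (ι → Bool) → ℝ) :
      ∑ x, ((if x = x₀ then 1 / 2 else 0) + (if x = x₁ then 1 / 2 else 0)) * g x =
        1 / 2 * g x₀ + 1 / 2 * g x₁ := by
    simp [add_mul, Finset.sum_add_distrib, ite_mul]
  refine ⟨⟨fun x => (if x = x₀ then 1 / 2 else 0) + (if x = x₁ then 1 / 2 else 0),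
    fun x => by positivity, ?_, fun x hx => ?_⟩, fun t ht => ?_⟩
  · have := hsum 1
    simp only [Pi.one_apply, mul_one] at this
    rw [this]
    norm_num
  · simp [ne_of_mem_of_not_mem hx₀ hx |>.symm, ne_of_mem_of_not_mem hx₁ hx |>.symm]
  · cases t with
    | node => simp [DTree.depth] at ht
    | leaf s =>
      rw [hsum, DTree.expLoss_leaf, DTree.expLoss_leaf, h₀, h₁]
      simp only [classSign, Bool.not_true, Bool.not_false, Bool.false_eq_true, if_false, if_true,
        one_mul, neg_one_mul]
      linarith [Real.add_one_le_exp s, Real.add_one_le_exp (-s)]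

theorem exists_maxL2Value_le_one {ι : Type} [Fintype ι] [DecidableEq ι] (f : (ι → Bool) → Bool)
    (X : Set (ι → Bool)) (h : 0 < Rwc X f (2 / 3)) :
    ∃ (D : ℕ) (μ : InputDist ι X), Rwc X f (2 / 3) ≤ 17 * (D + 1) ∧
      maxL2Value f (Real.exp (-(2 / (D + 1 : ℝ)))) μ.μ ≤ 1 := by
  set r := Rwc X f (2 / 3) with hr
  set D := (r - 1) / 17 with hD
  have hα : (1 / (4 * (D + 1 : ℝ))) * (D + 1) = 1 / 4 := by field_simp
  obtain ⟨μ, hμ⟩ : ∃ μ : InputDist ι X, ∀ t : DTree ι ℝ, t.depth ≤ D →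
      1 ≤ ∑ x, μ.μ x * t.expLoss f (1 / (4 * (D + 1 : ℝ))) x := by
    rcases Nat.eq_zero_or_pos D with h0 | h0
    · rw [h0]
      exact exists_hard_of_nonconst f X _ h
    · exact exists_hard_of_lt_Rwc f X hα (by omega)
  refine ⟨D, μ, by omega, ?_⟩
  have := maxL2Value_le_one f hα μ.nonneg μ.sum_one hμ
  rwa [show 8 * (1 / (4 * (D + 1 : ℝ))) = 2 / (D + 1) by field_simp; norm_num] at this

/-- Upper bound on the success probability of a bounded-depth algorithm for the threshold task. -/
theorem threshold_success_le {m n k : ℕ} {X : Set (Fin m → Bool)} (f : (Fin m → Bool) → Bool)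
    {θ : ℝ} (hθ : 0 < θ) (hθ1 : θ ≤ 1) (μ : InputDist (Fin m) X)
    (hμ : maxL2Value f θ μ.μ ≤ 1) (R : RandAlg (Fin n × Fin m) (Fin n → Bool)) {T : ℕ}
    (hT : ∀ j, R.p j ≠ 0 → (R.T j).depth ≤ T) {δ : ℝ}
    (hδ : ∀ x ∈ Xpow n X, δ ≤ ∑ j, if k ≤ (Finset.univ.filter fun i =>
      (R.T j).out x i = fpow f x i).card then R.p j else 0) :
    θ ^ T * δ ≤ √((∑ i ∈ Finset.range (n - k + 1), (n.choose i : ℝ)) / 2 ^ n) := by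
  set C := √((∑ i ∈ Finset.range (n - k + 1), (n.choose i : ℝ)) / 2 ^ n)
  have htree (j) : R.p j * (θ ^ T * ∑ x, if k ≤ (Finset.univ.filter fun i =>
      (R.T j).out x i = fpow f x i).card then ∏ i, μ.μ (block x i) else 0) ≤ R.p j * C := by
    by_cases hj : R.p j = 0
    · simp [hj]
    refine mul_le_mul_of_nonneg_left ?_ (R.p_nonneg j)
    refine (success_weight_le f hθ hθ1 k (R.T j) T (hT j hj) fun _ => μ.nonneg).trans ?_
    refine mul_le_of_le_one_right (Real.sqrt_nonneg _) (Finset.prod_le_one (fun i _ => ?_)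
      fun i _ => hμ)
    exact (l2Score_nonneg f μ.μ).trans (l2Score_le_maxL2Value f hθ.le hθ1 μ.nonneg)
  have havg : δ ≤ ∑ x : Fin n × Fin m → Bool, (∏ i, μ.μ (block x i)) *
      ∑ j, if k ≤ (Finset.univ.filter fun i => (R.T j).out x i = fpow f x i).card
        then R.p j else 0 := by
    have h1 : ∑ x : Fin n × Fin m → Bool, ∏ i, μ.μ (block x i) = 1 := by
      rw [sum_prod_block fun _ => μ.μ]
      simp [μ.sum_one]
    rw [← one_mul δ, ← h1, Finset.sum_mul]
    refine Finset.sum_le_sum fun x _ => ?_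
    by_cases hx : x ∈ Xpow n X
    · exact mul_le_mul_of_nonneg_left (hδ x hx) (Finset.prod_nonneg fun i _ => μ.nonneg _)
    · obtain ⟨i, hi⟩ := not_forall.1 hx
      rw [Finset.prod_eq_zero (Finset.mem_univ i) (μ.supp _ hi), zero_mul, zero_mul]
  have hle := Finset.sum_le_sum fun j (_ : j ∈ Finset.univ) => htree j
  rw [← Finset.sum_mul, R.p_sum, one_mul] at hle
  refine (mul_le_mul_of_nonneg_left havg (by positivity)).trans (le_of_eq_of_le ?_ hle)
  simp only [Finset.mul_sum]
  rw [Finset.sum_comm]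
  refine Finset.sum_congr rfl fun j _ => Finset.sum_congr rfl fun x _ => ?_
  split_ifs <;> ring

theorem exists_threshold_alg {m n k : ℕ} (X : Set (Fin m → Bool)) (f : (Fin m → Bool) → Bool)
    (hk : k ≤ n) {δ : ℝ} (hδ : δ ≤ 1) :
    ∃ R : RandAlg (Fin n × Fin m) (Fin n → Bool),
      (∀ j, R.p j ≠ 0 → (R.T j).depth ≤ RwcThr X f n k δ) ∧
      ∀ x ∈ Xpow n X, δ ≤ ∑ j, if k ≤ (Finset.univ.filter fun i =>
        (R.T j).out x i = fpow f x i).card then R.p j else 0 := by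
  classical
  obtain ⟨t, ht⟩ := DTree.exists_out_eq (fpow (n := n) f)
  obtain ⟨R, -, hR, hd⟩ := Nat.sInf_mem (s := {d : ℕ | ∃ R : RandAlg (Fin n × Fin m) (Fin n → Bool),
    (∀ j, R.p j ≠ 0 → (R.T j).allLabels fun _ => True) ∧
    (∀ x ∈ Xpow n X, δ ≤ ∑ j, if k ≤ (Finset.univ.filter fun i =>
      (R.T j).out x i = fpow f x i).card then R.p j else 0) ∧
    ∀ j, R.p j ≠ 0 → (R.T j).depth ≤ d})
    ⟨t.depth, ⟨1, fun _ => 1, fun _ => t, by simp, by simp⟩,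
      fun _ _ => DTree.allLabels_true _, fun x _ => by simpa [ht, hk] using hδ, by simp⟩
  refine ⟨R, fun j hj => (hd j hj).trans_eq ?_, hR⟩
  unfold RwcThr RwcTask
  congr! 13

end Threshold

/-- **Threshold direct product theorem**: with
`τ_{n,k} = n − log₂(Σ_{i=0}^{n−k} C(n,i))`, there exist universal constants `c ∈ (1/2,1)`
and `c' > 0` such that `R_{γ^{τ_{n,k}}}(Thr_kⁿ ∘ f) ≥ c'·τ_{n,k}·R(f)` for all `γ ∈ [c,1)`. -/
theorem threshold_direct_product_theorem :
    ∃ c c' : ℝ, 1 / 2 < c ∧ c < 1 ∧ 0 < c' ∧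
      ∀ (m : ℕ) (X : Set (Fin m → Bool)) (f : (Fin m → Bool) → Bool) (n k : ℕ),
        n < 2 * k → k ≤ n → ∀ γ : ℝ, c ≤ γ → γ < 1 →
        c' * ((n : ℝ) - Real.logb 2 (∑ i ∈ Finset.range (n - k + 1), (n.choose i : ℝ)))
            * (Rwc X f (2 / 3) : ℝ) ≤
          (RwcThr X f n k
            (γ ^ ((n : ℝ) - Real.logb 2 (∑ i ∈ Finset.range (n - k + 1), (n.choose i : ℝ)))) :
            ℝ) := by
  refine ⟨9 / 10, 1 / 200, by norm_num, by norm_num, by norm_num, ?_⟩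
  intro m X f n k _ hkn γ hγ hγ1
  set V := ∑ i ∈ Finset.range (n - k + 1), (n.choose i : ℝ) with hV
  set τ := (n : ℝ) - Real.logb 2 V with hτ
  rcases Nat.eq_zero_or_pos (Rwc X f (2 / 3)) with h0 | hpos
  · simp [h0]
  have hV1 : 1 ≤ V := by
    rw [hV, Finset.sum_range_succ']
    simp only [Nat.choose_zero_right, Nat.cast_one]
    linarith [Finset.sum_nonneg fun i (_ : i ∈ Finset.range (n - k)) =>
      (Nat.cast_nonneg (n.choose (i + 1)) : (0 : ℝ) ≤ _)]
  have hV2 : V ≤ 2 ^ n := by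
    have : ∑ i ∈ Finset.range (n + 1), (n.choose i : ℝ) = 2 ^ n := by
      exact_mod_cast Nat.sum_range_choose n
    rw [← this]
    exact Finset.sum_le_sum_of_subset_of_nonneg (Finset.range_mono (by omega))
      fun _ _ _ => Nat.cast_nonneg _
  have hV0 : 0 < V := by linarith
  have hl2 := Real.log_two_gt_d9
  have hl2pos : 0 < Real.log 2 := by linarith
  have hτlog : Real.log (V / 2 ^ n) = -(τ * Real.log 2) := by
    rw [Real.log_div hV0.ne' (by positivity), Real.log_pow, hτ, Real.logb]
    field_simp
    ring
  have hτ0 : 0 ≤ τ := by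
    have : Real.log (V / 2 ^ n) ≤ 0 :=
      Real.log_nonpos (by positivity) ((div_le_one (by positivity)).2 hV2)
    rw [hτlog] at this
    by_contra! h
    nlinarith
  have hγ0 : 0 < γ := by linarith
  obtain ⟨R, hd, hR⟩ := exists_threshold_alg X f hkn (Real.rpow_le_one hγ0.le hγ1.le hτ0)
  obtain ⟨D, μ, hD, hμ⟩ := exists_maxL2Value_le_one f X hpos
  have hD0 : (0 : ℝ) < D + 1 := by positivity
  set T := RwcThr X f n k (γ ^ τ)
  have hmain := threshold_success_le f (Real.exp_pos _)
    (Real.exp_le_one_iff.2 (neg_nonpos.2 (by positivity))) μ hμ R hd hR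
  have hlog := Real.log_le_log (by positivity) hmain
  rw [Real.log_mul (by positivity) (by positivity), Real.log_pow, Real.log_exp,
    Real.log_rpow hγ0, Real.log_sqrt (by positivity), hτlog] at hlog
  have hγlog : -(1 / 9) ≤ Real.log γ := by
    have h1 := Real.one_sub_inv_le_log_of_pos hγ0
    have h2 : γ⁻¹ ≤ 10 / 9 := by
      rw [inv_le_comm₀ hγ0 (by norm_num)]
      linarith
    linarith
  have hbound : τ * (1 / 5) ≤ T * (2 / (D + 1 : ℝ)) := by
    nlinarith [mul_nonneg hτ0 (by linarith : 0 ≤ Real.log γ + Real.log 2 / 2 - 1 / 5)]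
  have hbound' : τ * (1 / 5) * (D + 1) ≤ T * 2 := by
    rwa [← le_div_iff₀ hD0, mul_div_assoc]
  have hD' : (Rwc X f (2 / 3) : ℝ) ≤ 17 * (D + 1) := by exact_mod_cast hD
  nlinarith [mul_le_mul_of_nonneg_left hD' hτ0]
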